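/- arXiv:1412.8223 — 6 statements merged into one kernel-verified Lean document; each statement's English description precedes it below -/
import Mathlib

section
/- Let p ≥ 2 and d ≥ 1 be integers, let K be a field equipped with an additive valuation v : K → ℚ ∪ {∞} (i.e., v(x) = ∞ iff x = 0, v(xy) = v(x) + v(y), and v(x+y) ≥ min(v(x), v(y))). Let a_1, …, a_d ∈ K satisfy v(a_l) ≥ 0 for all l, and let b : ℕ → K satisfy v(b_i) ≥ i/(p-1) for all 0 ≤ i ≤ p² - 1. For n ∈ ℕ define h_n := Σ_{(i_1,…,i_d) ∈ ℕ^d, i_1 + 2i_2 + ⋯ + d·i_d = n} a_1^{i_1} ⋯ a_d^{i_d} · b_{i_1} ⋯ b_{i_d}. Then for every n with 0 ≤ n ≤ p² - 1 one has v(h_n) ≥ n/(d(p-1)). -/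
theorem AddValuation.sum_le_map_prod {K ι : Type*} [Field K]
    (w : AddValuation K (WithTop ℚ)) (s : Finset ι) (f : ι → K) (c : ι → ℚ)
    (hc : ∀ l ∈ s, (c l : WithTop ℚ) ≤ w (f l)) :
    ((∑ l ∈ s, c l : ℚ) : WithTop ℚ) ≤ w (∏ l ∈ s, f l) := by
  classical
  induction s using Finset.induction_on with
  | empty => simp
  | insert x s hx ih =>
    rw [Finset.sum_insert hx, Finset.prod_insert hx, w.map_mul, WithTop.coe_add]
    exact add_le_add (hc x (Finset.mem_insert_self x s))
      (ih fun l hl => hc l (Finset.mem_insert_of_mem hl))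


/-- Lemma 3.1 (i): if `v bᵢ ≥ i/(p-1)` for `0 ≤ i ≤ p²-1` and `v aₗ ≥ 0`, then the
convolution coefficients `hₙ = ∑_{i₁+2i₂+⋯+d·i_d=n} a₁^{i₁}⋯a_d^{i_d} b_{i₁}⋯b_{i_d}`
satisfy `v hₙ ≥ n/(d(p-1))` for `0 ≤ n ≤ p²-1`. -/
theorem stmt0 (p d : ℕ) (hp : 2 ≤ p) (hd : 1 ≤ d)
    (K : Type*) [Field K] (v : K → WithTop ℚ)
    (hv0 : ∀ x : K, v x = ⊤ ↔ x = 0)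
    (hvmul : ∀ x y : K, v (x * y) = v x + v y)
    (hvadd : ∀ x y : K, min (v x) (v y) ≤ v (x + y))
    (a : Fin d → K) (ha : ∀ l : Fin d, 0 ≤ v (a l))
    (b : ℕ → K)
    (hb : ∀ i : ℕ, i ≤ p ^ 2 - 1 → (((i : ℚ) / ((p : ℚ) - 1) : ℚ) : WithTop ℚ) ≤ v (b i))
    (h : ℕ → K)
    (hh : ∀ n : ℕ, h n =
      ∑ i ∈ (Fintype.piFinset fun _ : Fin d => Finset.range (n + 1)).filter
          (fun i : Fin d → ℕ => ∑ l : Fin d, (l.1 + 1) * i l = n),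
        (∏ l : Fin d, a l ^ i l) * ∏ l : Fin d, b (i l)) :
    ∀ n : ℕ, n ≤ p ^ 2 - 1 →
      (((n : ℚ) / ((d : ℚ) * ((p : ℚ) - 1)) : ℚ) : WithTop ℚ) ≤ v (h n) := by
  have hv1 : v 1 = 0 := by
    have hne : v 1 ≠ ⊤ := fun H => one_ne_zero ((hv0 1).1 H)
    have hmul := hvmul 1 1
    rw [mul_one] at hmul
    lift v 1 to ℚ using hne with q
    norm_cast at hmul ⊢
    linarith
  let w : AddValuation K (WithTop ℚ) := AddValuation.of v ((hv0 0).2 rfl) hv1 hvadd hvmul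
  intro n hn
  have hp1 : (0 : ℚ) < (p : ℚ) - 1 := by
    have : (2 : ℚ) ≤ p := by exact_mod_cast hp
    linarith
  have hd0 : (0 : ℚ) < d := by exact_mod_cast hd
  rw [hh n]
  change _ ≤ w _
  refine w.map_le_sum fun i hi => ?_
  obtain ⟨hi, hin⟩ := Finset.mem_filter.1 hi
  have hle : ∀ l, i l ≤ n := fun l =>
    Nat.lt_succ_iff.1 (Finset.mem_range.1 (Fintype.mem_piFinset.1 hi l))
  have hA : (0 : WithTop ℚ) ≤ w (∏ l : Fin d, a l ^ i l) := by
    have := w.sum_le_map_prod Finset.univ (fun l => a l ^ i l) (fun _ => 0) fun l _ => by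
      rw [w.map_pow]
      exact nsmul_nonneg (ha l) _
    simpa using this
  have hB := w.sum_le_map_prod Finset.univ (fun l => b (i l))
    (fun l => (i l : ℚ) / ((p : ℚ) - 1)) fun l _ => hb (i l) ((hle l).trans hn)
  have hweight : (n : ℚ) ≤ d * ∑ l : Fin d, (i l : ℚ) := by
    have : n ≤ d * ∑ l : Fin d, i l := by
      rw [← hin, Finset.mul_sum]
      exact Finset.sum_le_sum fun l _ => Nat.mul_le_mul_right _ l.2
    exact_mod_cast this
  have hbound : (n : ℚ) / ((d : ℚ) * ((p : ℚ) - 1)) ≤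
      ∑ l : Fin d, (i l : ℚ) / ((p : ℚ) - 1) := by
    rw [← Finset.sum_div, ← div_div]
    gcongr
    exact (div_le_iff₀' hd0).2 hweight
  rw [w.map_mul]
  exact (WithTop.coe_le_coe.2 hbound).trans (hB.trans (le_add_of_nonneg_left hA))
end

section
/- Let p ≥ 2 and d ≥ 1 be integers, let K be a field equipped with an additive valuation v : K → ℚ ∪ {∞} (i.e., v(x) = ∞ iff x = 0, v(xy) = v(x) + v(y), and v(x+y) ≥ min(v(x), v(y))). Let a_1, …, a_d ∈ K satisfy v(a_l) ≥ 0 for all l, and let b : ℕ → K satisfy v(b_i) ≥ i/(p-1) for all 0 ≤ i ≤ p² - 1 and v(b_i) ≥ (p-1)i/p² for all i ≥ p². For n ∈ ℕ define h_n := Σ_{(i_1,…,i_d) ∈ ℕ^d, i_1 + 2i_2 + ⋯ + d·i_d = n} a_1^{i_1} ⋯ a_d^{i_d} · b_{i_1} ⋯ b_{i_d}. Then for every n ≥ p² one has v(h_n) ≥ (p-1)n/(d p²). -/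
/-- A multiplicative-to-additive map sends a product to at least the sum of lower bounds. -/
theorem coe_sum_le_map_prod {K ι : Type*} [CommMonoid K] {v : K → WithTop ℚ}
    (hv1 : 0 ≤ v 1) (hvmul : ∀ x y : K, v (x * y) = v x + v y)
    (s : Finset ι) (f : ι → K) (g : ι → ℚ)
    (hfg : ∀ l ∈ s, ((g l : ℚ) : WithTop ℚ) ≤ v (f l)) :
    ((∑ l ∈ s, g l : ℚ) : WithTop ℚ) ≤ v (∏ l ∈ s, f l) := by
  classical
  induction s using Finset.induction_on with
  | empty => simpa using hv1
  | insert l s hl ih =>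
    rw [Finset.sum_insert hl, Finset.prod_insert hl, hvmul, WithTop.coe_add]
    exact add_le_add (hfg l (Finset.mem_insert_self l s))
      (ih fun j hj => hfg j (Finset.mem_insert_of_mem hj))

/-- The ultrametric inequality for finite sums. -/
theorem le_map_sum_of_forall_le {K Γ ι : Type*} [AddCommMonoid K] [LinearOrder Γ] [OrderTop Γ]
    {v : K → Γ} (hv0 : v 0 = ⊤) (hvadd : ∀ x y : K, min (v x) (v y) ≤ v (x + y))
    (s : Finset ι) (f : ι → K) (c : Γ) (hf : ∀ l ∈ s, c ≤ v (f l)) :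
    c ≤ v (∑ l ∈ s, f l) :=
  Finset.sum_induction f (fun x => c ≤ v x)
    (fun x y hx hy => (le_min hx hy).trans (hvadd x y)) (hv0 ▸ le_top) hf

theorem map_one_eq_zero_of_map_mul {K : Type*} [Monoid K] {v : K → WithTop ℚ}
    (hv1 : v 1 ≠ ⊤) (hvmul : ∀ x y : K, v (x * y) = v x + v y) : v 1 = 0 := by
  have h := hvmul 1 1
  rw [mul_one] at h
  lift v 1 to ℚ using hv1 with q
  norm_cast at h ⊢
  linarith

theorem nonneg_map_pow {K : Type*} [Monoid K] {v : K → WithTop ℚ}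
    (hv1 : 0 ≤ v 1) (hvmul : ∀ x y : K, v (x * y) = v x + v y)
    {x : K} (hx : 0 ≤ v x) (n : ℕ) : 0 ≤ v (x ^ n) := by
  induction n with
  | zero => simpa using hv1
  | succ n ih => rw [pow_succ, hvmul]; exact add_nonneg ih hx

theorem weighted_sum_le_mul_sum {d : ℕ} (i : Fin d → ℕ) :
    ∑ l : Fin d, (l.1 + 1) * i l ≤ d * ∑ l : Fin d, i l := by
  rw [Finset.mul_sum]
  exact Finset.sum_le_sum fun l _ => Nat.mul_le_mul_right _ l.2


/-- Lemma 3.1 (ii): if additionally `v bᵢ ≥ (p-1)i/p²` for `i ≥ p²`, then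
`v hₙ ≥ (p-1)n/(d p²)` for `n ≥ p²`. -/
theorem stmt1 (p d : ℕ) (hp : 2 ≤ p) (hd : 1 ≤ d)
    (K : Type*) [Field K] (v : K → WithTop ℚ)
    (hv0 : ∀ x : K, v x = ⊤ ↔ x = 0)
    (hvmul : ∀ x y : K, v (x * y) = v x + v y)
    (hvadd : ∀ x y : K, min (v x) (v y) ≤ v (x + y))
    (a : Fin d → K) (ha : ∀ l : Fin d, 0 ≤ v (a l))
    (b : ℕ → K)
    (hb₁ : ∀ i : ℕ, i ≤ p ^ 2 - 1 → (((i : ℚ) / ((p : ℚ) - 1) : ℚ) : WithTop ℚ) ≤ v (b i))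
    (hb₂ : ∀ i : ℕ, p ^ 2 ≤ i →
      ((((p : ℚ) - 1) * (i : ℚ) / ((p : ℚ) ^ 2) : ℚ) : WithTop ℚ) ≤ v (b i))
    (h : ℕ → K)
    (hh : ∀ n : ℕ, h n =
      ∑ i ∈ (Fintype.piFinset fun _ : Fin d => Finset.range (n + 1)).filter
          (fun i : Fin d → ℕ => ∑ l : Fin d, (l.1 + 1) * i l = n),
        (∏ l : Fin d, a l ^ i l) * ∏ l : Fin d, b (i l)) :
    ∀ n : ℕ, p ^ 2 ≤ n →
      ((((p : ℚ) - 1) * (n : ℚ) / ((d : ℚ) * (p : ℚ) ^ 2) : ℚ) : WithTop ℚ) ≤ v (h n) := by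
  intro n _
  have hp' : (2 : ℚ) ≤ p := by exact_mod_cast hp
  have hd' : (0 : ℚ) < d := by exact_mod_cast hd
  have hv1 : 0 ≤ v 1 :=
    (map_one_eq_zero_of_map_mul (fun h1 => one_ne_zero ((hv0 1).1 h1)) hvmul).ge
  have hb : ∀ i : ℕ, ((((p : ℚ) - 1) / (p : ℚ) ^ 2 * i : ℚ) : WithTop ℚ) ≤ v (b i) := by
    intro i
    rcases le_or_gt (p ^ 2) i with hi | hi
    · simpa only [div_mul_eq_mul_div] using hb₂ i hi
    · refine le_trans (WithTop.coe_le_coe.2 ?_) (hb₁ i (Nat.le_sub_one_of_lt hi))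
      have hle : ((p : ℚ) - 1) / (p : ℚ) ^ 2 ≤ 1 / ((p : ℚ) - 1) := by
        rw [div_le_div_iff₀ (by positivity) (by linarith)]
        nlinarith
      calc ((p : ℚ) - 1) / (p : ℚ) ^ 2 * i ≤ 1 / ((p : ℚ) - 1) * i := by gcongr
        _ = i / ((p : ℚ) - 1) := by ring
  rw [hh]
  refine le_map_sum_of_forall_le ((hv0 0).2 rfl) hvadd _ _ _ fun i hi => ?_
  have hn : (n : ℚ) ≤ d * ∑ l : Fin d, (i l : ℚ) := by
    have := weighted_sum_le_mul_sum i
    rw [(Finset.mem_filter.1 hi).2] at this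
    exact_mod_cast this
  have hva : 0 ≤ v (∏ l : Fin d, a l ^ i l) := by
    simpa using coe_sum_le_map_prod hv1 hvmul Finset.univ (fun l => a l ^ i l) (fun _ => 0)
      fun l _ => nonneg_map_pow hv1 hvmul (ha l) (i l)
  have hvb := coe_sum_le_map_prod hv1 hvmul Finset.univ (fun l => b (i l)) _ fun l _ => hb (i l)
  rw [hvmul]
  refine le_trans (le_trans (WithTop.coe_le_coe.2 ?_) hvb) (le_add_of_nonneg_left hva)
  have hc : 0 ≤ ((p : ℚ) - 1) / (p : ℚ) ^ 2 := div_nonneg (by linarith) (by positivity)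
  rw [← Finset.mul_sum]
  calc ((p : ℚ) - 1) * n / (d * (p : ℚ) ^ 2) = ((p : ℚ) - 1) / (p : ℚ) ^ 2 * (n / d) := by
        field_simp
    _ ≤ ((p : ℚ) - 1) / (p : ℚ) ^ 2 * ∑ l : Fin d, (i l : ℚ) :=
        mul_le_mul_of_nonneg_left ((div_le_iff₀' hd').2 hn) hc
end

section
/- Let p be a prime and let K be a field equipped with an additive valuation v : K → ℚ ∪ {∞} (i.e., v(x) = ∞ iff x = 0, v(xy) = v(x) + v(y), and v(x+y) ≥ min(v(x), v(y))). Let π ∈ K satisfy v(π) = 1/(p−1). Let G : ℕ → K be such that v(G(k)) ∈ ℤ ∪ {∞} for every k with 1 ≤ k ≤ p−1. Suppose S := Σ_{k=1}^{p−1} π^k G(k) is nonzero and that there is an integer k₀ with 1 ≤ k₀ ≤ p−1 and v(S) − k₀/(p−1) ∈ ℤ. Then G(k₀) ≠ 0, v(S) = v(π^{k₀} G(k₀)), and for every k with 1 ≤ k ≤ p−1 and k ≠ k₀ one has v(π^{k₀} G(k₀)) < v(π^k G(k)). -/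
/-- If one summand has strictly smaller valuation than all the others, then it determines the
valuation of the sum. -/
theorem AddValuation.map_sum_eq_of_lt {R Γ₀ ι : Type*} [Ring R]
    [LinearOrderedAddCommMonoidWithTop Γ₀] [DecidableEq ι] (v : AddValuation R Γ₀)
    {s : Finset ι} {f : ι → R} {j : ι} (hj : j ∈ s) (hfin : v (f j) ≠ ⊤)
    (hlt : ∀ i ∈ s, i ≠ j → v (f j) < v (f i)) :
    v (∑ i ∈ s, f i) = v (f j) := by
  rw [← Finset.add_sum_erase s f hj]
  refine v.map_add_eq_of_lt_left (v.map_lt_sum hfin fun i hi => ?_)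
  exact hlt i (Finset.mem_of_mem_erase hi) (Finset.ne_of_mem_erase hi)

/-- Two elements of `{1, …, n}` whose quotients by `n` differ by an integer are equal. -/
theorem eq_of_div_add_int_eq {n a b : ℕ} (ha : 1 ≤ a) (han : a ≤ n) (hb : 1 ≤ b) (hbn : b ≤ n)
    {y z : ℤ} (h : (a : ℚ) / n + y = b / n + z) : a = b := by
  have hn : (n : ℚ) ≠ 0 := by
    have : n ≠ 0 := by omega
    exact_mod_cast this
  field_simp at h
  have h' : (a : ℤ) + n * y = b + n * z := by exact_mod_cast h
  have hdvd : (n : ℤ) ∣ (a : ℤ) - b := ⟨z - y, by linear_combination h'⟩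
  have hzero : (a : ℤ) - b = 0 :=
    Int.eq_zero_of_abs_lt_dvd hdvd (abs_lt.mpr ⟨by omega, by omega⟩)
  omega


/-- Proposition 4.1 (localization of the minimum): if `S = ∑_{k=1}^{p−1} πᵏ G k ≠ 0`
and `v S − k₀/(p−1) ∈ ℤ` for some `1 ≤ k₀ ≤ p−1`, then `G k₀ ≠ 0`,
`v S = v(π^{k₀} G k₀)`, and `v(π^{k₀} G k₀) < v(πᵏ G k)` for all `k ≠ k₀`. -/
theorem stmt8 (p : ℕ) (hp : p.Prime) (K : Type*) [Field K]
    (v : K → WithTop ℚ)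
    (hv0 : ∀ x : K, v x = ⊤ ↔ x = 0)
    (hvmul : ∀ x y : K, v (x * y) = v x + v y)
    (hvadd : ∀ x y : K, min (v x) (v y) ≤ v (x + y))
    (π : K) (hπ : v π = ((1 / ((p : ℚ) - 1) : ℚ) : WithTop ℚ))
    (G : ℕ → K)
    (hG : ∀ k : ℕ, 1 ≤ k → k ≤ p - 1 →
      v (G k) = ⊤ ∨ ∃ z : ℤ, v (G k) = ((z : ℚ) : WithTop ℚ))
    (S : K) (hSdef : S = ∑ k ∈ Finset.Icc 1 (p - 1), π ^ k * G k) (hS : S ≠ 0)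
    (k₀ : ℕ) (hk₀ : 1 ≤ k₀) (hk₀' : k₀ ≤ p - 1)
    (hvS : ∃ z : ℤ, v S = (((k₀ : ℚ) / ((p : ℚ) - 1) + (z : ℚ) : ℚ) : WithTop ℚ)) :
    G k₀ ≠ 0 ∧ v S = v (π ^ k₀ * G k₀) ∧
      ∀ k : ℕ, 1 ≤ k → k ≤ p - 1 → k ≠ k₀ →
        v (π ^ k₀ * G k₀) < v (π ^ k * G k) := by
  classical
  have h_one : v 1 = 0 := by
    have hne : v 1 ≠ ⊤ := fun h => one_ne_zero ((hv0 1).mp h)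
    have h := hvmul 1 1
    rw [mul_one] at h
    lift v 1 to ℚ using hne with q
    norm_cast at h ⊢
    linarith
  let w : AddValuation K (WithTop ℚ) := AddValuation.of v ((hv0 0).mpr rfl) h_one hvadd hvmul
  have hp1 : ((p - 1 : ℕ) : ℚ) = (p : ℚ) - 1 := by
    rw [Nat.cast_sub hp.one_le, Nat.cast_one]
  rw [← hp1] at hπ hvS
  have hterm : ∀ k : ℕ, 1 ≤ k → k ≤ p - 1 → v (π ^ k * G k) ≠ ⊤ →
      ∃ z : ℤ, v (π ^ k * G k) = (((k : ℚ) / ((p - 1 : ℕ) : ℚ) + z : ℚ) : WithTop ℚ) := by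
    intro k hk hk' hfin
    have hpow : v (π ^ k) = (((k : ℚ) / ((p - 1 : ℕ) : ℚ) : ℚ) : WithTop ℚ) := by
      have h : v (π ^ k) = k • v π := w.map_pow π k
      rw [h, hπ, ← WithTop.coe_nsmul, nsmul_eq_mul, mul_one_div]
    rw [hvmul, hpow] at hfin ⊢
    rcases hG k hk hk' with h | ⟨z, h⟩
    · exact absurd (by rw [h, WithTop.add_top]) hfin
    · exact ⟨z, by rw [h, ← WithTop.coe_add]⟩
  obtain ⟨j, hj, hmin⟩ := (Finset.Icc 1 (p - 1)).exists_min_image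
    (fun k => v (π ^ k * G k)) ⟨k₀, Finset.mem_Icc.mpr ⟨hk₀, hk₀'⟩⟩
  obtain ⟨hj1, hj2⟩ := Finset.mem_Icc.mp hj
  have hjfin : v (π ^ j * G j) ≠ ⊤ := by
    intro htop
    refine hS (hSdef.trans (Finset.sum_eq_zero fun k hk => (hv0 _).mp ?_))
    exact top_le_iff.mp (htop ▸ hmin k hk)
  obtain ⟨y, hy⟩ := hterm j hj1 hj2 hjfin
  have hlt : ∀ k ∈ Finset.Icc 1 (p - 1), k ≠ j → v (π ^ j * G j) < v (π ^ k * G k) := by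
    intro k hk hkj
    refine lt_of_le_of_ne (hmin k hk) fun heq => hkj ?_
    obtain ⟨hk1, hk2⟩ := Finset.mem_Icc.mp hk
    obtain ⟨z, hz⟩ := hterm k hk1 hk2 (heq ▸ hjfin)
    rw [hy, hz, WithTop.coe_inj] at heq
    exact (eq_of_div_add_int_eq hj1 hj2 hk1 hk2 heq).symm
  have hvSj : v S = v (π ^ j * G j) := hSdef ▸ w.map_sum_eq_of_lt hj hjfin hlt
  obtain ⟨z, hz⟩ := hvS
  obtain rfl : k₀ = j := by
    rw [hz, hy, WithTop.coe_inj] at hvSj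
    exact eq_of_div_add_int_eq hk₀ hk₀' hj1 hj2 hvSj
  refine ⟨fun h => hjfin ((hv0 _).mpr (by rw [h, mul_zero])), hvSj, fun k hk hk' hne => ?_⟩
  exact hlt k (Finset.mem_Icc.mpr ⟨hk, hk'⟩) hne
end

section
/- Let p be a prime and let K be a field equipped with an additive valuation v : K → ℚ ∪ {∞} (i.e., v(x) = ∞ iff x = 0, v(xy) = v(x) + v(y), and v(x+y) ≥ min(v(x), v(y))). Let π ∈ K satisfy v(π) = 1/(p−1). Let G : ℕ → K be such that v(G(k)) ∈ ℤ ∪ {∞} for every k with 1 ≤ k ≤ p−1. Suppose S := Σ_{k=1}^{p−1} π^k G(k) is nonzero and that there is an integer k₀ with 1 ≤ k₀ ≤ p−1 and v(S) − k₀/(p−1) ∈ ℤ. Then: (a) for every k with 1 ≤ k < k₀, v(G(k₀)) < v(G(k)); and (b) for every k with k₀ < k ≤ p−1, v(G(k₀)) < 1 + v(G(k)). -/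
/-- If the finite values of the terms of a sum are pairwise distinct and the sum has finite value,
then a unique term has the least value, and this is the value of the sum. -/
theorem AddValuation.exists_map_sum_eq {R Γ₀ ι : Type*} [Ring R]
    [LinearOrderedAddCommMonoidWithTop Γ₀] (w : AddValuation R Γ₀) {s : Finset ι} {f : ι → R}
    (hs : w (∑ i ∈ s, f i) ≠ ⊤)
    (hf : ∀ i ∈ s, ∀ j ∈ s, w (f i) ≠ ⊤ → w (f i) = w (f j) → i = j) :
    ∃ j ∈ s, w (∑ i ∈ s, f i) = w (f j) ∧ ∀ i ∈ s, i ≠ j → w (f j) < w (f i) := by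
  classical
  have hne : s.Nonempty := by
    rw [Finset.nonempty_iff_ne_empty]
    rintro rfl
    simp at hs
  obtain ⟨j, hj, hmin⟩ := s.exists_min_image (fun i => w (f i)) hne
  have hjtop : w (f j) ≠ ⊤ := fun h =>
    hs (top_le_iff.1 (h ▸ w.map_le_sum hmin))
  have hlt : ∀ i ∈ s, i ≠ j → w (f j) < w (f i) := fun i hi hij =>
    lt_of_le_of_ne (hmin i hi) fun h => hij (hf j hj i hi hjtop h).symm
  refine ⟨j, hj, ?_, hlt⟩
  rw [← Finset.add_sum_erase s f hj]
  refine w.map_add_eq_of_lt_left (w.map_lt_sum hjtop fun i hi => ?_)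
  exact hlt i (Finset.mem_of_mem_erase hi) (Finset.ne_of_mem_erase hi)

/-- Fractions `i / n` with `1 ≤ i ≤ n` are distinct modulo the integers. -/
theorem eq_of_div_add_intCast_eq {n i j : ℕ} (hi : 1 ≤ i) (hin : i ≤ n) (hj : 1 ≤ j)
    (hjn : j ≤ n) {a b : ℤ} (h : (i : ℚ) / n + a = (j : ℚ) / n + b) : i = j := by
  have hn : (n : ℚ) ≠ 0 := by
    norm_cast
    lia
  field_simp at h
  have h' : (i : ℤ) + n * a = j + n * b := by exact_mod_cast h
  have hmod : (i : ℤ) - j = n * (b - a) := by linarith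
  have hzero : (i : ℤ) - j = 0 :=
    Int.eq_zero_of_abs_lt_dvd ⟨b - a, hmod⟩ (by rw [abs_lt]; lia)
  lia


/-- Proposition 4.1 (the two comparison inequalities): under the assumptions of the
localization claim, `v(G k₀) < v(G k)` for `1 ≤ k < k₀`, and
`v(G k₀) < 1 + v(G k)` for `k₀ < k ≤ p−1`. -/
theorem stmt9 (p : ℕ) (hp : p.Prime) (K : Type*) [Field K]
    (v : K → WithTop ℚ)
    (hv0 : ∀ x : K, v x = ⊤ ↔ x = 0)
    (hvmul : ∀ x y : K, v (x * y) = v x + v y)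
    (hvadd : ∀ x y : K, min (v x) (v y) ≤ v (x + y))
    (π : K) (hπ : v π = ((1 / ((p : ℚ) - 1) : ℚ) : WithTop ℚ))
    (G : ℕ → K)
    (hG : ∀ k : ℕ, 1 ≤ k → k ≤ p - 1 →
      v (G k) = ⊤ ∨ ∃ z : ℤ, v (G k) = ((z : ℚ) : WithTop ℚ))
    (S : K) (hSdef : S = ∑ k ∈ Finset.Icc 1 (p - 1), π ^ k * G k) (hS : S ≠ 0)
    (k₀ : ℕ) (hk₀ : 1 ≤ k₀) (hk₀' : k₀ ≤ p - 1)
    (hvS : ∃ z : ℤ, v S = (((k₀ : ℚ) / ((p : ℚ) - 1) + (z : ℚ) : ℚ) : WithTop ℚ)) :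
    (∀ k : ℕ, 1 ≤ k → k < k₀ → v (G k₀) < v (G k)) ∧
    (∀ k : ℕ, k₀ < k → k ≤ p - 1 → v (G k₀) < ((1 : ℚ) : WithTop ℚ) + v (G k)) := by
  have h1 : v 1 = 0 := by
    have h := hvmul 1 1
    rw [mul_one] at h
    have htop : v 1 ≠ ⊤ := fun h => one_ne_zero ((hv0 1).1 h)
    lift v 1 to ℚ using htop with q
    norm_cast at h ⊢
    linarith
  let w : AddValuation K (WithTop ℚ) := AddValuation.of v ((hv0 0).2 rfl) h1 hvadd hvmul
  obtain ⟨n, rfl⟩ : ∃ n, p = n + 1 := ⟨p - 1, by have := hp.one_lt; lia⟩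
  simp only [Nat.add_sub_cancel, Nat.cast_add, Nat.cast_one, add_sub_cancel_right] at *
  have hn : (0 : ℚ) < n := by
    norm_cast
    lia
  have hterm : ∀ k : ℕ, w (π ^ k * G k) = ((k / n : ℚ) : WithTop ℚ) + v (G k) := by
    intro k
    have hpow : w (π ^ k) = ((k / n : ℚ) : WithTop ℚ) := by
      have hw : w π = ((1 / n : ℚ) : WithTop ℚ) := hπ
      rw [w.map_pow, hw, ← WithTop.coe_nsmul, nsmul_eq_mul, mul_one_div]
    rw [w.map_mul, hpow]
    rfl
  have hStop : w (∑ k ∈ Finset.Icc 1 n, π ^ k * G k) ≠ ⊤ := fun h =>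
    hS (hSdef ▸ (hv0 _).1 h)
  obtain ⟨j, hj, hSj, hlt⟩ := w.exists_map_sum_eq hStop (by
    intro i hi j hj hitop hij
    rw [Finset.mem_Icc] at hi hj
    rw [hterm] at hitop
    rw [hterm, hterm] at hij
    obtain hGi | ⟨a, hGi⟩ := hG i hi.1 hi.2
    · simp [hGi] at hitop
    obtain hGj | ⟨b, hGj⟩ := hG j hj.1 hj.2
    · rw [hGi, hGj, ← WithTop.coe_add, WithTop.add_top] at hij
      exact absurd hij WithTop.coe_ne_top
    rw [hGi, hGj] at hij
    exact eq_of_div_add_intCast_eq hi.1 hi.2 hj.1 hj.2 (by exact_mod_cast hij))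
  rw [hSj] at hStop
  rw [← hSdef] at hSj
  obtain ⟨z, hz⟩ := hvS
  have hjz : w (π ^ j * G j) = ((k₀ / n + z : ℚ) : WithTop ℚ) := hSj.symm.trans hz
  rw [Finset.mem_Icc] at hj
  rw [hterm] at hjz hStop
  obtain hGj | ⟨b, hGj⟩ := hG j hj.1 hj.2
  · simp [hGj] at hStop
  obtain rfl : j = k₀ := by
    rw [hGj] at hjz
    exact eq_of_div_add_intCast_eq hj.1 hj.2 hk₀ hk₀' (by exact_mod_cast hjz)
  have key : ∀ k : ℕ, 1 ≤ k → k ≤ n → k ≠ j → ∀ c : ℤ, v (G k) = ((c : ℚ) : WithTop ℚ) →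
      (j : ℤ) + n * b < k + n * c := by
    intro k hk hkn hkj c hc
    have h := hlt k (Finset.mem_Icc.2 ⟨hk, hkn⟩) hkj
    rw [hterm, hterm, hGj, hc, ← WithTop.coe_add, ← WithTop.coe_add, WithTop.coe_lt_coe] at h
    field_simp at h
    exact_mod_cast h
  constructor
  · intro k hk hkj
    obtain hGk | ⟨c, hGk⟩ := hG k hk (hkj.le.trans hk₀')
    · simp [hGj, hGk]
    have h := key k hk (hkj.le.trans hk₀') hkj.ne c hGk
    have hbc : b < c := by
      by_contra! hcb
      nlinarith
    rw [hGj, hGk]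
    exact_mod_cast hbc
  · intro k hjk hkn
    obtain hGk | ⟨c, hGk⟩ := hG k (hk₀.trans hjk.le) hkn
    · rw [hGj, hGk, WithTop.add_top]
      exact WithTop.coe_lt_top _
    have h := key k (hk₀.trans hjk.le) hkn hjk.ne' c hGk
    have hbc : b < 1 + c := by
      by_contra! hcb
      nlinarith
    rw [hGj, hGk, ← WithTop.coe_add, WithTop.coe_lt_coe]
    exact_mod_cast hbc
end

section
/- Let p be a prime and let K be a field of characteristic zero equipped with an additive valuation v : K → ℚ ∪ {∞} (i.e., v(x) = ∞ iff x = 0, v(xy) = v(x) + v(y), and v(x+y) ≥ min(v(x), v(y))) whose restriction to ℚ ⊆ K is the p-adic valuation ord_p. Let π ∈ K satisfy v(π) = 1/(p−1). Let e ≥ 1 and let P_0, …, P_{e−1} ∈ ℤ[X] be polynomials, not all of whose coefficient sets are divisible by p; let i₀ be the largest index i such that p does not divide all coefficients of P_i. Let G : ℕ → K satisfy: (1) v(G(k)) ∈ ℤ ∪ {∞} for every 1 ≤ k ≤ p−1; (2) for every integer m with 1 ≤ m ≤ p − e, Σ_{i=0}^{e−1} P_i(m+i)·G(m+i) = 0.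 Suppose S := Σ_{k=1}^{p−1} π^k G(k) is nonzero and there is an integer k₀ with e < k₀ ≤ p − e such that v(S) − k₀/(p−1) ∈ ℤ. Then p divides the integer P_{i₀}(k₀). -/
theorem natCast_eq_of_div_add_int_eq {d a b : ℕ} {y z : ℤ} (ha : 1 ≤ a) (had : a ≤ d)
    (hb : 1 ≤ b) (hbd : b ≤ d)
    (h : (a : ℚ) / d + y = (b : ℚ) / d + z) : a = b := by
  have hd : (d : ℚ) ≠ 0 := by
    have : d ≠ 0 := by omega
    exact_mod_cast this
  have h1 : (a : ℚ) + y * d = b + z * d := by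
    field_simp at h
    linarith
  have h2 : (a : ℤ) + y * d = b + z * d := by exact_mod_cast h1
  have h3 : (d : ℤ) ∣ (a : ℤ) - b := ⟨z - y, by linarith⟩
  have h4 : (a : ℤ) - b = 0 := by
    refine Int.eq_zero_of_abs_lt_dvd h3 ?_
    rw [abs_lt]
    omega
  omega

/-- If the terms of a finite sum have pairwise distinct valuations wherever they do not vanish,
then a nonzero sum has the valuation of its strictly dominant term. -/
theorem AddValuation.exists_map_sum_eq_of_injOn {ι K Γ : Type*} [DecidableEq ι] [Ring K]
    [LinearOrderedAddCommMonoidWithTop Γ] (w : AddValuation K Γ) (s : Finset ι) (t : ι → K)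
    (hinj : ∀ i ∈ s, ∀ j ∈ s, w (t i) ≠ ⊤ → w (t i) = w (t j) → i = j)
    (hs : w (∑ i ∈ s, t i) ≠ ⊤) :
    ∃ j ∈ s, w (∑ i ∈ s, t i) = w (t j) ∧ ∀ i ∈ s, i ≠ j → w (t j) < w (t i) := by
  have hne : s.Nonempty := by
    rw [Finset.nonempty_iff_ne_empty]
    rintro rfl
    simp at hs
  obtain ⟨j, hj, hmin⟩ := s.exists_min_image (fun i => w (t i)) hne
  have htop : w (t j) ≠ ⊤ := by
    intro h
    apply hs
    rw [← top_le_iff, ← h]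
    exact w.map_le_sum hmin
  have hlt : ∀ i ∈ s, i ≠ j → w (t j) < w (t i) := fun i hi hij =>
    lt_of_le_of_ne (hmin i hi) fun h => hij (hinj j hj i hi htop h).symm
  refine ⟨j, hj, ?_, hlt⟩
  rw [← Finset.add_sum_erase s t hj]
  refine w.map_add_eq_of_lt_left (w.map_lt_sum htop fun i hi => ?_)
  exact hlt i (Finset.mem_of_mem_erase hi) (Finset.ne_of_mem_erase hi)

theorem AddValuation.map_intCast_nonneg {K : Type*} [Ring K] (w : AddValuation K (WithTop ℚ))
    (n : ℤ) : 0 ≤ w (n : K) := by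
  have hnat : ∀ m : ℕ, 0 ≤ w (m : K) := by
    intro m
    induction m with
    | zero => simp
    | succ m ih =>
      rw [Nat.cast_succ]
      exact w.map_le_add ih (w.map_one).ge
  obtain ⟨m, rfl | rfl⟩ := n.eq_nat_or_neg
  · simpa using hnat m
  · simpa [w.map_neg] using hnat m

theorem AddValuation.one_le_map_intCast_of_dvd {K : Type*} [Ring K]
    (w : AddValuation K (WithTop ℚ)) {p : ℕ} (hwp : w (p : K) = 1) {n : ℤ} (h : (p : ℤ) ∣ n) :
    1 ≤ w (n : K) := by
  obtain ⟨c, rfl⟩ := h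
  push_cast
  rw [w.map_mul, hwp]
  exact le_add_of_nonneg_right (w.map_intCast_nonneg c)

theorem AddValuation.dvd_of_map_intCast_pos {K : Type*} [Ring K]
    (w : AddValuation K (WithTop ℚ)) {p : ℕ} (hp : p.Prime) (hwp : w (p : K) = 1) {n : ℤ}
    (h : 0 < w (n : K)) : (p : ℤ) ∣ n := by
  by_contra hn
  have hcop : IsCoprime (p : ℤ) n :=
    (Nat.prime_iff_prime_int.mp hp).coprime_iff_not_dvd.mpr hn
  obtain ⟨a, b, hab⟩ := hcop
  have h1 : w ((a : K) * p + b * n) = 0 := by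
    have : (a : K) * p + b * n = 1 := by exact_mod_cast congrArg (Int.cast : ℤ → K) hab
    rw [this, w.map_one]
  have h2 : 0 < w ((a : K) * p + b * n) := by
    refine w.map_lt_add ?_ ?_
    · rw [w.map_mul, hwp]
      exact lt_of_lt_of_le zero_lt_one (le_add_of_nonneg_left (w.map_intCast_nonneg a))
    · rw [w.map_mul]
      exact lt_of_lt_of_le h (le_add_of_nonneg_left (w.map_intCast_nonneg b))
  exact h2.ne' h1

theorem Polynomial.dvd_eval_of_forall_dvd_coeff {R : Type*} [CommSemiring R] {a : R}
    {f : Polynomial R} (h : ∀ k, a ∣ f.coeff k) (x : R) : a ∣ f.eval x := by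
  rw [Polynomial.eval_eq_sum]
  exact Finset.dvd_sum fun k _ => (h k).mul_right _


/-- Proposition 4.1: let `v` extend the `p`-adic valuation of `ℚ`, `v π = 1/(p−1)`,
and let `G` satisfy the recurrence `∑_{i=0}^{e−1} Pᵢ(m+i) G(m+i) = 0` for
`1 ≤ m ≤ p−e`, where the `Pᵢ ∈ ℤ[X]` are not all divisible by `p` and `i₀` is the
largest index with `p ∤ P_{i₀}`. If `S = ∑_{k=1}^{p−1} πᵏ G k ≠ 0` and
`v S − k₀/(p−1) ∈ ℤ` with `e < k₀ ≤ p−e`, then `p ∣ P_{i₀}(k₀)`. -/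
theorem stmt10 (p : ℕ) (hp : p.Prime) (K : Type*) [Field K] [CharZero K]
    (v : K → WithTop ℚ)
    (hv0 : ∀ x : K, v x = ⊤ ↔ x = 0)
    (hvmul : ∀ x y : K, v (x * y) = v x + v y)
    (hvadd : ∀ x y : K, min (v x) (v y) ≤ v (x + y))
    (hvrat : ∀ q : ℚ, q ≠ 0 → v ((q : K)) = (((padicValRat p q : ℤ) : ℚ) : WithTop ℚ))
    (π : K) (hπ : v π = ((1 / ((p : ℚ) - 1) : ℚ) : WithTop ℚ))
    (e : ℕ) (he : 1 ≤ e) (P : Fin e → Polynomial ℤ)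
    (i₀ : Fin e)
    (hi₀ : ¬ ∀ k : ℕ, (p : ℤ) ∣ (P i₀).coeff k)
    (hi₀' : ∀ i : Fin e, i₀ < i → ∀ k : ℕ, (p : ℤ) ∣ (P i).coeff k)
    (G : ℕ → K)
    (hG1 : ∀ k : ℕ, 1 ≤ k → k ≤ p - 1 →
      v (G k) = ⊤ ∨ ∃ z : ℤ, v (G k) = ((z : ℚ) : WithTop ℚ))
    (hG2 : ∀ m : ℕ, 1 ≤ m → m ≤ p - e →
      ∑ i : Fin e, (((P i).eval ((m : ℤ) + (i.1 : ℤ)) : ℤ) : K) * G (m + i.1) = 0)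
    (S : K) (hSdef : S = ∑ k ∈ Finset.Icc 1 (p - 1), π ^ k * G k) (hS : S ≠ 0)
    (k₀ : ℕ) (hk₀ : e < k₀) (hk₀' : k₀ ≤ p - e)
    (hvS : ∃ z : ℤ, v S = (((k₀ : ℚ) / ((p : ℚ) - 1) + (z : ℚ) : ℚ) : WithTop ℚ)) :
    (p : ℤ) ∣ (P i₀).eval (k₀ : ℤ) := by
  classical
  have hp1 : ((p - 1 : ℕ) : ℚ) = (p : ℚ) - 1 := by
    rw [Nat.cast_sub hp.one_le, Nat.cast_one]
  have hv1 : v 1 = 0 := by simpa using hvrat 1 one_ne_zero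
  have hvp : v (p : K) = 1 := by
    have := hvrat p (by exact_mod_cast hp.ne_zero)
    rw [padicValRat.self hp.one_lt] at this
    simpa using this
  let w : AddValuation K (WithTop ℚ) := AddValuation.of v ((hv0 0).2 rfl) hv1 hvadd hvmul
  have hw : ∀ x, w x = v x := fun _ => rfl
  have hwp : w (p : K) = 1 := hvp
  have hπk : ∀ k : ℕ, w (π ^ k) = (((k : ℚ) / ((p - 1 : ℕ) : ℚ) : ℚ) : WithTop ℚ) := by
    intro k
    rw [w.map_pow, hw, hπ, hp1, ← WithTop.coe_nsmul, nsmul_eq_mul, mul_one_div]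
  have hterm : ∀ k (z : ℤ), v (G k) = ((z : ℚ) : WithTop ℚ) →
      w (π ^ k * G k) = (((k : ℚ) / ((p - 1 : ℕ) : ℚ) + z : ℚ) : WithTop ℚ) := by
    intro k z hz
    rw [w.map_mul, hπk, hw, hz, WithTop.coe_add]
  have hterm_top : ∀ k, v (G k) = ⊤ → w (π ^ k * G k) = ⊤ := by
    intro k hk
    rw [w.map_mul, hw (G k), hk, add_top]
  obtain ⟨j, hj, hSj, hlt⟩ := w.exists_map_sum_eq_of_injOn (Finset.Icc 1 (p - 1))
    (fun k => π ^ k * G k) (by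
      intro a ha b hb hne hab
      rw [Finset.mem_Icc] at ha hb
      rcases hG1 a ha.1 ha.2 with h | ⟨y, hy⟩
      · exact absurd (hterm_top a h) hne
      rcases hG1 b hb.1 hb.2 with h | ⟨z, hz⟩
      · exact absurd (hab.trans (hterm_top b h)) hne
      simp only [hterm a y hy, hterm b z hz] at hab
      exact natCast_eq_of_div_add_int_eq ha.1 ha.2 hb.1 hb.2 (WithTop.coe_injective hab))
    (by rw [← hSdef]; exact fun h => hS ((hv0 S).1 h))
  rw [← hSdef] at hSj
  obtain ⟨z₀, hz₀⟩ := hvS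
  rw [hw, hz₀, ← hp1] at hSj
  rw [Finset.mem_Icc] at hj
  obtain ⟨z, hz⟩ : ∃ z : ℤ, v (G j) = ((z : ℚ) : WithTop ℚ) := by
    rcases hG1 j hj.1 hj.2 with h | h
    · rw [hterm_top j h] at hSj
      exact absurd hSj (WithTop.coe_ne_top)
    · exact h
  have hjk : k₀ = j := by
    rw [hterm j z hz] at hSj
    exact natCast_eq_of_div_add_int_eq (by omega) (by omega) hj.1 hj.2
      (WithTop.coe_injective hSj)
  subst hjk
  have hpos : (0 : ℚ) < ((p - 1 : ℕ) : ℚ) := by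
    have : 0 < p - 1 := by omega
    exact_mod_cast this
  have hbelow : ∀ k, 1 ≤ k → k < k₀ → v (G k₀) + 1 ≤ v (G k) := by
    intro k h1 hk
    have hl := hlt k (Finset.mem_Icc.2 ⟨h1, by omega⟩) hk.ne
    rcases hG1 k h1 (by omega) with h | ⟨y, hy⟩
    · rw [h]; exact le_top
    simp only [hterm k y hy, hterm k₀ z hz, WithTop.coe_lt_coe] at hl
    have hdiv : (k : ℚ) / ((p - 1 : ℕ) : ℚ) ≤ (k₀ : ℚ) / ((p - 1 : ℕ) : ℚ) := by
      gcongr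
    have hzy : z < y := by
      have : (z : ℚ) < y := by linarith
      exact_mod_cast this
    rw [hz, hy]
    have : (z : ℚ) + 1 ≤ y := by exact_mod_cast hzy
    exact_mod_cast this
  have habove : ∀ k, k₀ < k → k ≤ p - 1 → v (G k₀) ≤ v (G k) := by
    intro k hk hkp
    have hl := hlt k (Finset.mem_Icc.2 ⟨by omega, hkp⟩) hk.ne'
    rcases hG1 k (by omega) hkp with h | ⟨y, hy⟩
    · rw [h]; exact le_top
    simp only [hterm k y hy, hterm k₀ z hz, WithTop.coe_lt_coe] at hl
    have hdiv : (k : ℚ) / ((p - 1 : ℕ) : ℚ) ≤ 1 := by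
      rw [div_le_one hpos]
      exact_mod_cast hkp
    have hdiv₀ : 0 ≤ (k₀ : ℚ) / ((p - 1 : ℕ) : ℚ) := by positivity
    have hzy : z < y + 1 := by
      have : (z : ℚ) < y + 1 := by linarith
      exact_mod_cast this
    rw [hz, hy]
    have : (z : ℚ) ≤ y := by exact_mod_cast Int.lt_add_one_iff.1 hzy
    exact_mod_cast this
  have hi₀e := i₀.2
  have hrec := hG2 (k₀ - i₀) (by omega) (by omega)
  rw [← Finset.add_sum_erase _ _ (Finset.mem_univ i₀)] at hrec
  have hsum : k₀ - (i₀ : ℕ) + i₀ = k₀ := by omega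
  have hsum' : ((k₀ - (i₀ : ℕ) : ℕ) : ℤ) + (i₀ : ℕ) = k₀ := by exact_mod_cast hsum
  rw [hsum, hsum', add_eq_zero_iff_eq_neg] at hrec
  have hmain : v (G k₀) + 1 ≤ w (((P i₀).eval (k₀ : ℤ) : ℤ) * G k₀) := by
    rw [hrec, w.map_neg]
    refine w.map_le_sum fun i hi => ?_
    have hie := i.2
    rw [w.map_mul, hw (G _)]
    rcases lt_or_gt_of_ne (Finset.ne_of_mem_erase hi) with hii | hii
    · have hii' : (i : ℕ) < i₀ := hii
      exact (hbelow _ (by omega) (by omega)).trans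
        (le_add_of_nonneg_left (w.map_intCast_nonneg _))
    · have hii' : (i₀ : ℕ) < i := hii
      rw [add_comm (v (G k₀))]
      exact add_le_add
        (w.one_le_map_intCast_of_dvd hwp
          (Polynomial.dvd_eval_of_forall_dvd_coeff (hi₀' i hii) _))
        (habove _ (by omega) (by omega))
  refine w.dvd_of_map_intCast_pos hp hwp (lt_of_lt_of_le zero_lt_one ?_)
  rw [w.map_mul, hw (G k₀), hz, add_comm] at hmain
  exact (WithTop.add_le_add_iff_right WithTop.coe_ne_top).1 hmain
end

section
/- Let Q ∈ ℤ[X, Y] be a polynomial in two variables and let s, r, D be integers with D ≥ 1. Suppose there are infinitely many primes p such that D divides s·p + r and p divides the integer D^{N}·Q((s·p + r)/D, p), where N is the degree of Q in X. Then Q(r/D, 0) = 0, i.e., r/D is a rational root of the one-variable polynomial Q(X, 0). -/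
/-- Clearing denominators in the first variable: `D ^ N * Q(a / D, b)`, with `N` the degree of `Q`
in that variable, is given by an integral expression in `a`, `D` and `b`. -/
theorem MvPolynomial.pow_degreeOf_mul_aeval_div (Q : MvPolynomial (Fin 2) ℤ) {D : ℤ} (hD : D ≠ 0)
    (a b : ℤ) :
    (D : ℚ) ^ Q.degreeOf 0 * MvPolynomial.aeval ![(a : ℚ) / D, (b : ℚ)] Q =
      ((∑ m ∈ Q.support, Q.coeff m * (D ^ (Q.degreeOf 0 - m 0) * a ^ m 0 * b ^ m 1) : ℤ) : ℚ) := by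
  have hD' : (D : ℚ) ≠ 0 := by exact_mod_cast hD
  rw [MvPolynomial.aeval_def, MvPolynomial.eval₂_eq', Finset.mul_sum]
  push_cast
  refine Finset.sum_congr rfl fun m hm => ?_
  have hle : m 0 ≤ Q.degreeOf 0 := MvPolynomial.monomial_le_degreeOf 0 hm
  rw [← Nat.sub_add_cancel hle, pow_add]
  simp [Fin.prod_univ_two, div_pow]
  field_simp

/-- Corollary 4.2 (arithmetic content): if `Q ∈ ℤ[X,Y]`, `N` is the `X`-degree of `Q`,
and for infinitely many primes `p` one has `D ∣ sp + r` and
`p ∣ D^N · Q((sp+r)/D, p)` (an integer), then `Q(r/D, 0) = 0`. -/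
theorem stmt11 (Q : MvPolynomial (Fin 2) ℤ) (s r D : ℤ) (hD : 1 ≤ D)
    (h : {p : ℕ | p.Prime ∧ D ∣ s * (p : ℤ) + r ∧
        ∃ z : ℤ, ((z : ℚ) = (D : ℚ) ^ (Q.degreeOf 0) *
            MvPolynomial.aeval ![(((s * (p : ℤ) + r : ℤ) : ℚ)) / (D : ℚ), ((p : ℕ) : ℚ)] Q ∧
          (p : ℤ) ∣ z)}.Infinite) :
    MvPolynomial.aeval ![((r : ℚ)) / (D : ℚ), (0 : ℚ)] Q = 0 := by
  have hD0 : D ≠ 0 := by lia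
  set F : ℤ → ℤ → ℤ := fun a b =>
    ∑ m ∈ Q.support, Q.coeff m * (D ^ (Q.degreeOf 0 - m 0) * a ^ m 0 * b ^ m 1) with hF
  have key (a b : ℤ) : (D : ℚ) ^ Q.degreeOf 0 *
      MvPolynomial.aeval ![(a : ℚ) / D, (b : ℚ)] Q = (F a b : ℚ) :=
    Q.pow_degreeOf_mul_aeval_div hD0 a b
  have hzero : F r 0 = 0 := by
    by_contra hne
    refine h ((Set.finite_Iic (F r 0).natAbs).subset ?_)
    rintro p ⟨-, -, z, hz, hpz⟩
    have hz' : z = F (s * p + r) p := by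
      have := key (s * p + r) p
      rw [Int.cast_natCast] at this
      exact_mod_cast hz.trans this
    have hp : (p : ℤ) ≡ 0 [ZMOD p] := Int.modEq_zero_iff_dvd.2 dvd_rfl
    have ha : s * p + r ≡ r [ZMOD p] := by simp
    have hmod : F (s * p + r) p ≡ F r 0 [ZMOD p] :=
      Int.ModEq.sum fun m _ => (((ha.pow _).mul_left _).mul (hp.pow _)).mul_left _
    rw [← hz'] at hmod
    have hdvd : (p : ℤ) ∣ F r 0 := hmod.dvd_iff.1 hpz
    exact Nat.le_of_dvd (Int.natAbs_pos.2 hne) (Int.natCast_dvd.1 hdvd)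
  have hr := key r 0
  rw [hzero, Int.cast_zero] at hr
  exact (mul_eq_zero.1 hr).resolve_left (pow_ne_zero _ (by exact_mod_cast hD0))
end
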